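/- Fix a natural number K ≥ 2 and natural numbers l, a. Every hierarchical partition P of the K-adic interval I(l+1,a) satisfies exactly one of the following: (i) P = {(l+1,a)}; or (ii) setting P_i = {(l',a') ∈ P : I(l',a') ⊆ I(l, K·a+i)} for i = 0,…,K−1, the sets P_0,…,P_{K−1} are pairwise disjoint, their union is P, and each P_i is a hierarchical partition of the child interval I(l, K·a+i). -/

import Mathlib

/-- The `K`-adic interval of level `l` and index `a`:
`I(l,a) = {x : ℕ | a·K^l ≤ x < (a+1)·K^l}`. -/
def kInt (K l a : ℕ) : Finset ℕ := Finset.Ico (a * K ^ l) ((a + 1) * K ^ l)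

/-- `P` is a hierarchical partition of the finite set `R`: the K-adic intervals
indexed by the pairs in `P` are pairwise disjoint and their union is `R`. -/
def IsHierPart (K : ℕ) (P : Finset (ℕ × ℕ)) (R : Finset ℕ) : Prop :=
  (∀ p ∈ P, ∀ q ∈ P, p ≠ q → Disjoint (kInt K p.1 p.2) (kInt K q.1 q.2)) ∧
  P.biUnion (fun p => kInt K p.1 p.2) = R

theorem mem_kInt_iff_div_eq {K : ℕ} (hK : 0 < K) {l a x : ℕ} :
    x ∈ kInt K l a ↔ x / K ^ l = a := by
  have hpow : 0 < K ^ l := pow_pos hK l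
  rw [kInt, Finset.mem_Ico, ← Nat.le_div_iff_mul_le hpow, ← Nat.div_lt_iff_lt_mul hpow]
  lia

theorem card_kInt (K l a : ℕ) : (kInt K l a).card = K ^ l := by
  rw [kInt, Nat.card_Ico, add_mul, one_mul, Nat.add_sub_cancel_left]

theorem kInt_nonempty {K : ℕ} (hK : 0 < K) (l a : ℕ) : (kInt K l a).Nonempty := by
  rw [← Finset.card_pos, card_kInt]
  exact pow_pos hK l

theorem eq_of_kInt_eq {K : ℕ} (hK : 2 ≤ K) {p q : ℕ × ℕ}
    (h : kInt K p.1 p.2 = kInt K q.1 q.2) : p = q := by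
  have hl : p.1 = q.1 := by
    apply Nat.pow_right_injective hK
    simpa only [card_kInt] using congrArg Finset.card h
  obtain ⟨x, hx⟩ := kInt_nonempty (by lia : 0 < K) p.1 p.2
  have hx' := h ▸ hx
  rw [mem_kInt_iff_div_eq (by lia)] at hx hx'
  exact Prod.ext hl (by rw [← hx, ← hx', hl])

/-- An interval is contained in every interval of a higher level that it meets. -/
theorem kInt_subset_of_mem {K : ℕ} (hK : 0 < K) {l' a' l a x : ℕ} (hl : l' ≤ l)
    (hx' : x ∈ kInt K l' a') (hx : x ∈ kInt K l a) : kInt K l' a' ⊆ kInt K l a := by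
  intro y hy
  rw [mem_kInt_iff_div_eq hK] at *
  rw [← hx, ← Nat.add_sub_cancel' hl, pow_add, ← Nat.div_div_eq_div_mul,
    ← Nat.div_div_eq_div_mul, hy, hx']

theorem mem_kInt_succ_iff {K : ℕ} (hK : 0 < K) {l a x : ℕ} :
    x ∈ kInt K (l + 1) a ↔ ∃ i < K, x ∈ kInt K l (K * a + i) := by
  simp only [mem_kInt_iff_div_eq hK, pow_succ, ← Nat.div_div_eq_div_mul]
  constructor
  · rintro rfl
    exact ⟨_, Nat.mod_lt _ hK, (Nat.div_add_mod _ _).symm⟩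
  · rintro ⟨i, hi, h⟩
    rw [h, Nat.mul_add_div hK, Nat.div_eq_of_lt hi, add_zero]

theorem IsHierPart.subset {K : ℕ} {P : Finset (ℕ × ℕ)} {R : Finset ℕ}
    (hP : IsHierPart K P R) {p : ℕ × ℕ} (hp : p ∈ P) : kInt K p.1 p.2 ⊆ R :=
  hP.2 ▸ Finset.subset_biUnion_of_mem (fun p => kInt K p.1 p.2) hp

theorem IsHierPart.eq_singleton {K : ℕ} (hK : 0 < K) {P : Finset (ℕ × ℕ)} {p : ℕ × ℕ}
    (hP : IsHierPart K P (kInt K p.1 p.2)) (hp : p ∈ P) : P = {p} := by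
  refine Finset.eq_singleton_iff_unique_mem.2 ⟨hp, fun q hq => ?_⟩
  by_contra hne
  obtain ⟨x, hx⟩ := kInt_nonempty hK q.1 q.2
  exact Finset.disjoint_left.1 (hP.1 q hq p hp hne) hx (hP.subset hq hx)

/-- An interval properly contained in `I(l+1,a)` lies in one of its children. -/
theorem exists_subset_child {K : ℕ} (hK : 2 ≤ K) {l a : ℕ} {p : ℕ × ℕ}
    (hsub : kInt K p.1 p.2 ⊆ kInt K (l + 1) a) (hne : p ≠ (l + 1, a)) :
    ∃ i < K, kInt K p.1 p.2 ⊆ kInt K l (K * a + i) := by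
  have hK0 : 0 < K := by lia
  have hl : p.1 ≤ l := by
    by_contra! hlt
    refine hne (eq_of_kInt_eq hK (Finset.eq_of_subset_of_card_le hsub ?_))
    rw [card_kInt, card_kInt]
    exact Nat.pow_le_pow_right hK0 hlt
  obtain ⟨x, hx⟩ := kInt_nonempty hK0 p.1 p.2
  obtain ⟨i, hi, hxi⟩ := (mem_kInt_succ_iff hK0).1 (hsub hx)
  exact ⟨i, hi, kInt_subset_of_mem hK0 hl hx hxi⟩

/-- Any hierarchical partition `P` of the coarse interval `I(l+1,a)` satisfies
exactly one of: (i) `P = {(l+1,a)}`, or (ii) the pieces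
`P_i = {(l',a') ∈ P : I(l',a') ⊆ I(l, K·a+i)}`, `i = 0,…,K−1`, are pairwise
disjoint, their union is `P`, and each `P_i` is a hierarchical partition of the
child interval `I(l, K·a+i)`. -/
theorem hierPart_parent_cases (K : ℕ) (hK : 2 ≤ K) (l a : ℕ) (P : Finset (ℕ × ℕ))
    (hP : IsHierPart K P (kInt K (l + 1) a)) :
    Xor' (P = {(l + 1, a)})
      ((∀ i ∈ Finset.range K, ∀ j ∈ Finset.range K, i ≠ j →
          Disjoint (P.filter (fun p => kInt K p.1 p.2 ⊆ kInt K l (K * a + i)))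
            (P.filter (fun p => kInt K p.1 p.2 ⊆ kInt K l (K * a + j)))) ∧
        (Finset.range K).biUnion
            (fun i => P.filter (fun p => kInt K p.1 p.2 ⊆ kInt K l (K * a + i))) = P ∧
        (∀ i ∈ Finset.range K,
          IsHierPart K (P.filter (fun p => kInt K p.1 p.2 ⊆ kInt K l (K * a + i)))
            (kInt K l (K * a + i)))) := by
  have hK0 : 0 < K := by lia
  by_cases hmem : (l + 1, a) ∈ P
  · refine Or.inl ⟨hP.eq_singleton (p := (l + 1, a)) hK0 hmem, ?_⟩
    rintro ⟨-, hunion, -⟩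
    rw [← hunion] at hmem
    simp only [Finset.mem_biUnion, Finset.mem_filter] at hmem
    obtain ⟨i, -, -, hsub⟩ := hmem
    have hcard := Finset.card_le_card hsub
    rw [card_kInt, card_kInt] at hcard
    exact (Nat.pow_lt_pow_right hK (Nat.lt_succ_self l)).not_ge hcard
  · have hchild : ∀ p ∈ P, ∃ i < K, kInt K p.1 p.2 ⊆ kInt K l (K * a + i) := fun p hp =>
      exists_subset_child hK (hP.subset hp) (ne_of_mem_of_not_mem hp hmem)
    have hunique : ∀ {i j x : ℕ}, x ∈ kInt K l (K * a + i) → x ∈ kInt K l (K * a + j) →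
        i = j := by
      intro i j x hi hj
      rw [mem_kInt_iff_div_eq hK0] at hi hj
      lia
    refine Or.inr ⟨⟨fun i _ j _ hij => ?_, ?_, fun i hi => ⟨?_, ?_⟩⟩, ?_⟩
    · refine Finset.disjoint_left.2 fun p hpi hpj => hij ?_
      obtain ⟨x, hx⟩ := kInt_nonempty hK0 p.1 p.2
      exact hunique ((Finset.mem_filter.1 hpi).2 hx) ((Finset.mem_filter.1 hpj).2 hx)
    · ext p
      simp only [Finset.mem_biUnion, Finset.mem_filter, Finset.mem_range]
      exact ⟨fun ⟨_, _, hp, _⟩ => hp, fun hp =>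
        let ⟨i, hi, hsub⟩ := hchild p hp
        ⟨i, hi, hp, hsub⟩⟩
    · exact fun p hp q hq => hP.1 p (Finset.mem_filter.1 hp).1 q (Finset.mem_filter.1 hq).1
    · refine (Finset.biUnion_subset.2 fun p hp => (Finset.mem_filter.1 hp).2).antisymm ?_
      intro x hx
      have hxP := (mem_kInt_succ_iff hK0).2 ⟨i, Finset.mem_range.1 hi, hx⟩
      rw [← hP.2] at hxP
      obtain ⟨p, hp, hxp⟩ := Finset.mem_biUnion.1 hxP
      obtain ⟨j, -, hsub⟩ := hchild p hp
      obtain rfl := hunique hx (hsub hxp)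
      exact Finset.mem_biUnion.2 ⟨p, Finset.mem_filter.2 ⟨hp, hsub⟩, hxp⟩
    · rintro rfl
      exact hmem (Finset.mem_singleton_self _)
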